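/- For every n ≥ 1 and every integer c with c·ℓ ≡ 1 (mod p^n), one has N_{ℚ(μ_{dp^n})/K(μ_{p^n})}(1 − ζ_{dp^n}) · N_{ℚ(μ_{dp^n})/K(μ_{p^n})}(1 − ι(ζ_{dp^n})) = (1 − ζ_{p^n}) · (1 − ζ_{p^n}^c)^{−1}, where N denotes the field norm. (This is the multiplicative, finite-level form of the first identity of Lemma 2.7 of the paper.) -/

import Mathlib

open Complex

/-- `ζ_N = exp(2πi/N)`. -/
noncomputable def zeta (N : ℕ) : ℂ := Complex.exp (2 * Real.pi * Complex.I / N)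

/-- `K(μ_N)`, the field obtained from the subfield `K ⊆ ℂ` by adjoining `ζ_N`. -/
noncomputable def Kmu (K : Subfield ℂ) (N : ℕ) : IntermediateField K ℂ :=
  IntermediateField.adjoin K {zeta N}

/-- `ζ_N` as an element of `K(μ_N)`. -/
noncomputable def zetaEl (K : Subfield ℂ) (N : ℕ) : Kmu K N :=
  ⟨zeta N, IntermediateField.subset_adjoin K {zeta N} rfl⟩

/-- The `N`-th cyclotomic field `ℚ(μ_N) ⊆ ℂ`. -/
noncomputable def Qmu (N : ℕ) : IntermediateField ℚ ℂ :=
  IntermediateField.adjoin ℚ {zeta N}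

open Polynomial in
theorem card_nthRootsFinset_complex {m : ℕ} (hm : m ≠ 0) {a : ℂ} (ha : a ≠ 0) :
    (nthRootsFinset m a).card = m := by
  have hprim := Complex.isPrimitiveRoot_exp m hm
  rw [nthRootsFinset_def, Multiset.toFinset_card_of_nodup (hprim.nthRoots_nodup ha),
    hprim.card_nthRoots, if_pos (IsAlgClosed.exists_pow_nat_eq a (Nat.pos_of_ne_zero hm))]

open Polynomial in
theorem prod_one_sub_nthRootsFinset_complex {m : ℕ} (hm : m ≠ 0) {a : ℂ} (ha : a ≠ 0) :
    ∏ x ∈ nthRootsFinset m a, (1 - x) = 1 - a := by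
  have hprim := Complex.isPrimitiveRoot_exp m hm
  have hsplit := (IsAlgClosed.splits (X ^ m - C a)).eq_prod_roots_of_monic
    (monic_X_pow_sub_C a hm)
  have heval := congrArg (Polynomial.eval 1) hsplit
  rw [← nthRoots, eval_multiset_prod, Multiset.map_map] at heval
  rw [Finset.prod_eq_multiset_prod, nthRootsFinset_def, Multiset.toFinset_val,
    (hprim.nthRoots_nodup ha).dedup]
  simpa using heval.symm

/-- Ring homomorphisms that agree on `z` agree on everything lying in `ℚ(z)`. -/
theorem RingHom.apply_eq_of_mem_adjoin_rat {L : Type*} [Field L] [CharZero L]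
    (i f g : L →+* ℂ) {z y : L} (hz : f z = g z)
    (hy : i y ∈ IntermediateField.adjoin ℚ {i z}) : f y = g y := by
  have hmap := IntermediateField.adjoin_map ℚ {z} i.toRatAlgHom
  rw [Set.image_singleton] at hmap
  have hy' : i y ∈ (IntermediateField.adjoin ℚ {z}).map i.toRatAlgHom := by
    rw [hmap]; exact hy
  obtain ⟨y', hy', hyy⟩ := hy'
  obtain rfl : y' = y := i.injective hyy
  clear hyy hy
  induction hy' using IntermediateField.adjoin_induction with
  | mem x hx => rw [Set.mem_singleton_iff.1 hx, hz]
  | algebraMap q => simp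
  | add x y _ _ hx hy => rw [map_add, map_add, hx, hy]
  | inv x _ hx => rw [map_inv₀, map_inv₀, hx]
  | mul x y _ _ hx hy => rw [map_mul, map_mul, hx, hy]

open Polynomial in
theorem norm_one_sub_mul_norm_one_sub {F E : Type*} [Field F] [Field E] [CharZero F]
    [Algebra F E] [FiniteDimensional F E] [Algebra F ℂ] {ℓ j m : ℕ} (hl : ℓ.Prime) (hm : m ≠ 0)
    {z z' : E} (hz : IsPrimitiveRoot z (ℓ ^ (j + 1) * m))
    (hz' : IsPrimitiveRoot z' (ℓ ^ (j + 1) * m))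
    (hgen : Function.Injective fun σ : E →ₐ[F] ℂ ↦ σ z) {ξ w : F}
    (hzξ : z ^ ℓ ^ (j + 1) = algebraMap F E ξ) (hz'ξ : z' ^ ℓ ^ (j + 1) = algebraMap F E ξ)
    (hwξ : w ^ ℓ = ξ) (hwm : w ^ m = 1) (hw : w ≠ 1)
    (hdeg : (ℓ ^ (j + 1)).totient ≤ 2 * Module.finrank F E)
    (hne : ∀ σ τ : E →ₐ[F] ℂ, σ z ≠ τ z') :
    Algebra.norm F (1 - z) * Algebra.norm F (1 - z') = (1 - ξ) * (1 - w)⁻¹ := by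
  classical
  rw [eq_mul_inv_iff_mul_eq₀ (sub_ne_zero.2 hw.symm)]
  apply (algebraMap F ℂ).injective
  have hw0 : w ≠ 0 := by rintro rfl; simp [hm] at hwm
  have hξ0 : ξ ≠ 0 := hwξ ▸ pow_ne_zero _ hw0
  have hw0' : algebraMap F ℂ w ≠ 0 := by simpa using hw0
  have hξ0' : algebraMap F ℂ ξ ≠ 0 := by simpa using hξ0
  have hlj : ∀ i, ℓ ^ i ≠ 0 := fun i ↦ pow_ne_zero _ hl.ne_zero
  set T := nthRootsFinset (ℓ ^ (j + 1)) (algebraMap F ℂ ξ) with hT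
  set T' := nthRootsFinset (ℓ ^ j) (algebraMap F ℂ w) with hT'
  have hsub : T' ⊆ T := by
    intro x hx
    rw [hT', mem_nthRootsFinset (Nat.pos_of_ne_zero (hlj _))] at hx
    rw [hT, mem_nthRootsFinset (Nat.pos_of_ne_zero (hlj _)), pow_succ, pow_mul, hx, ← map_pow, hwξ]
  have hmem : ∀ y : E, IsPrimitiveRoot y (ℓ ^ (j + 1) * m) →
      y ^ ℓ ^ (j + 1) = algebraMap F E ξ → ∀ σ : E →ₐ[F] ℂ, σ y ∈ T \ T' := by
    intro y hy hyξ σ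
    rw [Finset.mem_sdiff, hT, hT', mem_nthRootsFinset (Nat.pos_of_ne_zero (hlj _)),
      mem_nthRootsFinset (Nat.pos_of_ne_zero (hlj _)), ← map_pow, ← map_pow, hyξ,
      AlgHom.commutes, ← AlgHom.commutes σ w]
    refine ⟨rfl, fun h ↦ ?_⟩
    have hpow : y ^ (ℓ ^ j * m) = 1 := by
      rw [pow_mul, σ.injective h, ← map_pow, hwm, map_one]
    have hle := Nat.le_of_dvd (Nat.pos_of_ne_zero (mul_ne_zero (hlj _) hm))
      (hy.dvd_of_pow_eq_one _ hpow)
    have hlt : ℓ ^ j * m < ℓ ^ (j + 1) * m :=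
      Nat.mul_lt_mul_of_pos_right (Nat.pow_lt_pow_right hl.one_lt j.lt_succ_self)
        (Nat.pos_of_ne_zero hm)
    omega
  have hgen' : Function.Injective fun σ : E →ₐ[F] ℂ ↦ σ z' := by
    intro σ τ h
    have : NeZero (ℓ ^ (j + 1) * m) := ⟨mul_ne_zero (hlj _) hm⟩
    obtain ⟨i, -, hi⟩ := hz'.eq_pow_of_pow_eq_one hz.pow_eq_one
    apply hgen
    simp only [← hi, map_pow] at h ⊢
    rw [h]
  set A := Finset.univ.image fun σ : E →ₐ[F] ℂ ↦ σ z with hA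
  set B := Finset.univ.image fun σ : E →ₐ[F] ℂ ↦ σ z' with hB
  have hdisj : Disjoint A B := by
    rw [Finset.disjoint_left]
    simp only [hA, hB, Finset.mem_image, Finset.mem_univ, true_and]
    rintro _ ⟨σ, rfl⟩ ⟨τ, hτ⟩
    exact hne σ τ hτ.symm
  have hunion : A ∪ B = T \ T' := by
    apply Finset.eq_of_subset_of_card_le
    · intro x hx
      simp only [hA, hB, Finset.mem_union, Finset.mem_image, Finset.mem_univ, true_and] at hx
      obtain ⟨σ, rfl⟩ | ⟨σ, rfl⟩ := hx
      exacts [hmem z hz hzξ σ, hmem z' hz' hz'ξ σ]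
    · rw [Finset.card_sdiff_of_subset hsub, hT, hT', card_nthRootsFinset_complex (hlj _) hξ0',
        card_nthRootsFinset_complex (hlj _) hw0', Finset.card_union_of_disjoint hdisj, hA, hB,
        Finset.card_image_of_injective _ hgen, Finset.card_image_of_injective _ hgen',
        Finset.card_univ, AlgHom.card, ← two_mul]
      refine le_trans (le_of_eq ?_) hdeg
      rw [Nat.totient_prime_pow_succ hl, Nat.mul_sub, mul_one, pow_succ]
  have hprod := Finset.prod_sdiff (f := fun x ↦ 1 - x) hsub
  rw [← hunion, Finset.prod_union hdisj, hA, hB, Finset.prod_image hgen.injOn,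
    Finset.prod_image hgen'.injOn, hT, hT', prod_one_sub_nthRootsFinset_complex (hlj _) hξ0',
    prod_one_sub_nthRootsFinset_complex (hlj _) hw0'] at hprod
  simpa [Algebra.norm_eq_prod_embeddings] using hprod

theorem totient_le_mul_finrank {K F E : Type*} [Field K] [Field F] [Field E] [CharZero K]
    [CharZero F] [CharZero E] [Algebra K F] [Algebra F E] [FiniteDimensional ℚ K]
    [FiniteDimensional K F] [FiniteDimensional F E] {d m : ℕ} (hd : d ≠ 0) (hm : m ≠ 0)
    (hdm : d.Coprime m) (hF : Module.finrank K F ≤ m.totient)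
    {z : E} (hz : IsPrimitiveRoot z (d * m)) :
    d.totient ≤ Module.finrank ℚ K * Module.finrank F E := by
  have : FiniteDimensional ℚ F := FiniteDimensional.trans ℚ K F
  have : FiniteDimensional ℚ E := FiniteDimensional.trans ℚ F E
  have hle := minpoly.natDegree_le (A := ℚ) z
  rw [← Polynomial.cyclotomic_eq_minpoly_rat hz (Nat.pos_of_ne_zero (mul_ne_zero hd hm)),
    Polynomial.natDegree_cyclotomic, Nat.totient_mul hdm, ← Module.finrank_mul_finrank ℚ F E,
    ← Module.finrank_mul_finrank ℚ K F] at hle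
  refine Nat.le_of_mul_le_mul_right (hle.trans ?_) (Nat.totient_pos.2 (Nat.pos_of_ne_zero hm))
  calc _ = Module.finrank ℚ K * Module.finrank F E * Module.finrank K F := by ring
    _ ≤ _ := Nat.mul_le_mul_left _ hF

theorem isPrimitiveRoot_zeta {N : ℕ} (hN : N ≠ 0) : IsPrimitiveRoot (zeta N) N :=
  Complex.isPrimitiveRoot_exp N hN

theorem zeta_mul_pow_left {a b : ℕ} (ha : a ≠ 0) : zeta (a * b) ^ a = zeta b := by
  have ha' : (a : ℂ) ≠ 0 := Nat.cast_ne_zero.2 ha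
  rw [zeta, zeta, ← Complex.exp_nat_mul, Nat.cast_mul, ← mul_div_assoc, mul_div_mul_left _ _ ha']

theorem finrank_Kmu_le (K : Subfield ℂ) {N : ℕ} (hN : N ≠ 0) :
    Module.finrank K (Kmu K N) ≤ N.totient := by
  have hprim := isPrimitiveRoot_zeta hN
  rw [Kmu, IntermediateField.adjoin.finrank
    (hprim.isIntegral (Nat.pos_of_ne_zero hN)).tower_top, ← Polynomial.natDegree_cyclotomic N K]
  refine Polynomial.natDegree_le_of_dvd (minpoly.dvd _ _ ?_) (Polynomial.cyclotomic_ne_zero N K)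
  rw [Polynomial.aeval_def, Polynomial.eval₂_eq_eval_map, Polynomial.map_cyclotomic]
  exact hprim.isRoot_cyclotomic (Nat.pos_of_ne_zero hN)

theorem stmt4
    -- `K` is an imaginary quadratic field, viewed as a subfield of `ℂ`
    (K : Subfield ℂ) [FiniteDimensional ℚ ↥K]
    (hquad : Module.finrank ℚ ↥K = 2)
    (him : ∃ z : ↥K, (z : ℂ).im ≠ 0)
    -- `p ≥ 5` is a prime that splits in `K`
    (p : ℕ) (hp : p.Prime) (hp5 : 5 ≤ p)
    (hsplit : ∃ P Q : Ideal (NumberField.RingOfIntegers ↥K), P.IsPrime ∧ Q.IsPrime ∧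
      P ≠ Q ∧ P * Q = Ideal.span {(p : NumberField.RingOfIntegers ↥K)})
    -- `d = ℓ^k` is a power of a prime `ℓ ≠ p` with `K ⊆ ℚ(μ_d)`
    (ℓ k : ℕ) (hl : ℓ.Prime) (hlp : ℓ ≠ p) (hk : 1 ≤ k)
    (hKd : ∀ x : ℂ, x ∈ K → x ∈ Qmu (ℓ ^ k))
    (n : ℕ) (hn : 1 ≤ n)
    -- `c` an integer with `c·ℓ ≡ 1 (mod p^n)`
    (c : ℤ) (hc : c * ℓ ≡ 1 [ZMOD (p : ℤ) ^ n])
    -- `ζ_{dp^n}` as an element of `ℚ(μ_{dp^n}) = K(μ_{p^n})(ζ_{dp^n})`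
    (ζbig : IntermediateField.adjoin ↥(Kmu K (p ^ n)) {zeta (ℓ ^ k * p ^ n)})
    (hζbig : (ζbig : ℂ) = zeta (ℓ ^ k * p ^ n))
    -- `ι` is the field automorphism of `ℚ(μ_{dp^n})` fixing `ℚ(μ_{p^n})` pointwise and
    -- sending `ζ_d = ζ_{dp^n}^{p^n}` to `ζ_d⁻¹`
    (ι : ↥(IntermediateField.adjoin ↥(Kmu K (p ^ n)) {zeta (ℓ ^ k * p ^ n)}) ≃+*
         ↥(IntermediateField.adjoin ↥(Kmu K (p ^ n)) {zeta (ℓ ^ k * p ^ n)}))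
    (hιfix : ∀ x : ↥(IntermediateField.adjoin ↥(Kmu K (p ^ n)) {zeta (ℓ ^ k * p ^ n)}),
      (x : ℂ) ∈ Qmu (p ^ n) → ι x = x)
    (hι : ι (ζbig ^ (p ^ n)) = (ζbig ^ (p ^ n))⁻¹) :
    Algebra.norm ↥(Kmu K (p ^ n)) (1 - ζbig) * Algebra.norm ↥(Kmu K (p ^ n)) (1 - ι ζbig)
      = (1 - zetaEl K (p ^ n)) * (1 - zetaEl K (p ^ n) ^ c)⁻¹ := by
  obtain ⟨j, rfl⟩ : ∃ j, k = j + 1 := ⟨k - 1, by omega⟩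
  have hm : p ^ n ≠ 0 := pow_ne_zero _ hp.ne_zero
  have hd : ℓ ^ (j + 1) ≠ 0 := pow_ne_zero _ hl.ne_zero
  have hdm : (ℓ ^ (j + 1)).Coprime (p ^ n) := ((Nat.coprime_primes hl hp).2 hlp).pow _ _
  have hfinF : FiniteDimensional K (Kmu K (p ^ n)) := IntermediateField.adjoin.finiteDimensional
    ((isPrimitiveRoot_zeta hm).isIntegral (Nat.pos_of_ne_zero hm)).tower_top
  have hfinE : FiniteDimensional (Kmu K (p ^ n))
      (IntermediateField.adjoin (Kmu K (p ^ n)) {zeta (ℓ ^ (j + 1) * p ^ n)}) :=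
    IntermediateField.adjoin.finiteDimensional ((isPrimitiveRoot_zeta (mul_ne_zero hd hm)).isIntegral
      (Nat.pos_of_ne_zero (mul_ne_zero hd hm))).tower_top
  have hz : IsPrimitiveRoot ζbig (ℓ ^ (j + 1) * p ^ n) := by
    have h := isPrimitiveRoot_zeta (mul_ne_zero hd hm)
    rw [← hζbig] at h
    exact h.of_map_of_injective (f := algebraMap _ ℂ) (FaithfulSMul.algebraMap_injective _ _)
  have hξ : IsPrimitiveRoot (zetaEl K (p ^ n)) (p ^ n) :=
    IsPrimitiveRoot.of_map_of_injective (f := algebraMap _ ℂ) (isPrimitiveRoot_zeta hm)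
      (FaithfulSMul.algebraMap_injective _ _)
  have hzξ : ζbig ^ ℓ ^ (j + 1) = algebraMap _ _ (zetaEl K (p ^ n)) := by
    apply Subtype.ext
    rw [SubmonoidClass.coe_pow, hζbig, zeta_mul_pow_left hd]
    rfl
  have hz'ξ : (ι ζbig) ^ ℓ ^ (j + 1) = algebraMap _ _ (zetaEl K (p ^ n)) := by
    rw [← map_pow, hzξ]
    exact hιfix _ (IntermediateField.subset_adjoin ℚ {zeta (p ^ n)} rfl)
  have hξc : (zetaEl K (p ^ n) ^ c) ^ ℓ = zetaEl K (p ^ n) := by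
    rw [← zpow_natCast, ← zpow_mul]
    obtain ⟨t, ht⟩ := hc.symm.dvd
    rw [eq_add_of_sub_eq ht, zpow_add₀ (hξ.ne_zero hm), zpow_one, zpow_mul, ← Nat.cast_pow,
      zpow_natCast, hξ.pow_eq_one, one_zpow, one_mul]
  refine norm_one_sub_mul_norm_one_sub hl hm hz (hz.map_of_injective ι.injective) ?_ hzξ hz'ξ hξc
    ?_ ?_ (hquad ▸ totient_le_mul_finrank hd hm hdm (finrank_Kmu_le K hm) hz) ?_
  · intro σ τ h
    refine IntermediateField.adjoin_algHom_ext _ fun x hx ↦ ?_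
    obtain rfl : ζbig = ⟨x, IntermediateField.subset_adjoin _ _ hx⟩ :=
      Subtype.ext (hζbig.trans hx.symm)
    exact h
  · rw [← zpow_natCast, zpow_comm, zpow_natCast, hξ.pow_eq_one, one_zpow]
  · intro h
    rw [h, one_pow] at hξc
    exact (Nat.one_lt_pow (by omega) hp.one_lt).ne (hξ.unique (hξc ▸ .one)).symm
  · intro σ τ hστ
    obtain ⟨x, hx⟩ := him
    set y := algebraMap (Kmu K (p ^ n))
      (IntermediateField.adjoin (Kmu K (p ^ n)) {zeta (ℓ ^ (j + 1) * p ^ n)})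
      (algebraMap K (Kmu K (p ^ n)) x)
    have hζd : ((ζbig ^ p ^ n : _) : ℂ) = zeta (ℓ ^ (j + 1)) := by
      rw [SubmonoidClass.coe_pow, hζbig, mul_comm, zeta_mul_pow_left hm]
    have hmem : algebraMap _ ℂ y ∈
        IntermediateField.adjoin ℚ {algebraMap _ ℂ (ζbig ^ p ^ n)} := by
      have := hKd x x.2
      rwa [Qmu, ← hζd] at this
    have hτ : σ y = τ (ι y) :=
      RingHom.apply_eq_of_mem_adjoin_rat (algebraMap _ ℂ) σ.toRingHom
        (τ.toRingHom.comp ι.toRingHom) (by simpa using congrArg (· ^ p ^ n) hστ) hmem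
    have hιy : ι y = y := τ.injective <|
      hτ.symm.trans ((σ.commutes _).trans (τ.commutes _).symm)
    have hbase : ((ι (ζbig ^ p ^ n) : _) : ℂ) = starRingEnd ℂ ((ζbig ^ p ^ n : _) : ℂ) := by
      rw [hι, IntermediateField.coe_inv, hζd, Complex.inv_eq_conj]
      exact (isPrimitiveRoot_zeta hd).norm'_eq_one hd
    have hconj : ((ι y : _) : ℂ) = starRingEnd ℂ (y : ℂ) :=
      RingHom.apply_eq_of_mem_adjoin_rat (algebraMap _ ℂ)
        ((algebraMap _ ℂ).comp ι.toRingHom) ((starRingEnd ℂ).comp (algebraMap _ ℂ)) hbase hmem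
    rw [hιy] at hconj
    exact hx (Complex.conj_eq_iff_im.1 hconj.symm)
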